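/- For every α ∈ (1/3, 1) and all reals n₁ > 1, d > 0, there exist constants C > 0 and k₀ > 0 such that for every k ≥ k₀ and every j ∈ {1, …, N − ⌊N^α⌋ − 2} one has |σ_{j+2} − 2σ_{j+1} + σ_j| ≤ C·N^{1−3α}. -/

import Mathlib

open Real Filter MeasureTheory

/-- θ = √(1 − 1/n₁²) -/
noncomputable def pekTheta (n₁ : ℝ) : ℝ := Real.sqrt (1 - 1 / n₁ ^ 2)

/-- M = n₁·k·d·θ -/
noncomputable def pekM (n₁ d k : ℝ) : ℝ := n₁ * k * d * pekTheta n₁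

/-- N = ⌊M/π⌋ -/
noncomputable def pekN (n₁ d k : ℝ) : ℕ := Nat.floor (pekM n₁ d k / Real.pi)

/-- `σ : ℕ → ℝ` enumerates the solutions of the dispersion relation
`tan y = −y/√(M² − y²)`, with `σ j` the unique solution in
`(π/2 + (j−1)π, π/2 + jπ) ∩ (0, M)`, for `j = 1, …, N`. -/
def IsModeFamily (n₁ d k : ℝ) (σ : ℕ → ℝ) : Prop :=
  ∀ j : ℕ, 1 ≤ j → j ≤ pekN n₁ d k →
    σ j ∈ Set.Ioo (Real.pi / 2 + ((j : ℝ) - 1) * Real.pi) (Real.pi / 2 + (j : ℝ) * Real.pi) ∧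
    σ j ∈ Set.Ioo 0 (pekM n₁ d k) ∧
    Real.tan (σ j) = - σ j / Real.sqrt ((pekM n₁ d k) ^ 2 - (σ j) ^ 2)

/-- ζ_j = √(M² − σ_j²) -/
noncomputable def pekZeta (n₁ d k y : ℝ) : ℝ := Real.sqrt ((pekM n₁ d k) ^ 2 - y ^ 2)

/-- A_j = √( (2/d) / (1 + sin²(σ_j)/ζ_j − sin(2σ_j)/(2σ_j)) ) -/
noncomputable def pekA (n₁ d k y : ℝ) : ℝ :=
  Real.sqrt ((2 / d) /
    (1 + Real.sin y ^ 2 / pekZeta n₁ d k y - Real.sin (2 * y) / (2 * y)))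

/-- The propagating mode profile φ_j. -/
noncomputable def pekPhi (n₁ d k y : ℝ) : ℝ → ℝ := fun x =>
  if x ≤ d then pekA n₁ d k y * Real.sin (y * x / d)
  else pekA n₁ d k y * Real.sin y * Real.exp (- pekZeta n₁ d k y * (x - d) / d)

/-- `σ_j + arcsin(σ_j/M) = jπ`. -/
lemma pek_phase (M y : ℝ) (j : ℕ) (hy0 : 0 < y) (hyM : y < M)
    (h1 : π / 2 + ((j : ℝ) - 1) * π < y) (h2 : y < π / 2 + (j : ℝ) * π)
    (ht : Real.tan y = - y / Real.sqrt (M ^ 2 - y ^ 2)) :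
    y + Real.arcsin (y / M) = j * π := by
  have hM : 0 < M := hy0.trans hyM
  have hyM1 : y / M < 1 := (div_lt_one hM).2 hyM
  have hyM0 : 0 < y / M := div_pos hy0 hM
  have e1 : Real.arctan (Real.tan (y - j * π)) = y - j * π :=
    Real.arctan_tan (by linarith) (by linarith)
  rw [Real.tan_sub_nat_mul_pi, ht] at e1
  have e2 : Real.sqrt (1 - (y / M) ^ 2) = Real.sqrt (M ^ 2 - y ^ 2) / M := by
    rw [show 1 - (y / M) ^ 2 = (M ^ 2 - y ^ 2) / M ^ 2 by field_simp,
      Real.sqrt_div' _ (by positivity), Real.sqrt_sq hM.le]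
  have e3 := Real.arcsin_eq_arctan (x := y / M) ⟨by linarith, hyM1⟩
  rw [e2, div_div_div_cancel_right₀ hM.ne'] at e3
  rw [neg_div, Real.arctan_neg, ← e3] at e1
  linarith

lemma pek_mvt (M a b : ℝ) (ha : 0 < a) (hab : a < b) (hb : b < M) :
    ∃ ξ, a < ξ ∧ ξ < b ∧
      Real.arcsin (b / M) - Real.arcsin (a / M) = (b - a) / Real.sqrt (M ^ 2 - ξ ^ 2) := by
  have hM : 0 < M := by linarith
  obtain ⟨ξ, hξ, h⟩ := exists_hasDerivAt_eq_slope (fun y => Real.arcsin (y / M))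
    (fun y => 1 / Real.sqrt (M ^ 2 - y ^ 2)) hab
    (Continuous.continuousOn (Real.continuous_arcsin.comp (by fun_prop))) (by
      intro y hy
      have hy1 : y / M < 1 := (div_lt_one hM).2 (by linarith [hy.2])
      have hy0 : 0 < y / M := div_pos (by linarith [hy.1]) hM
      have e2 : Real.sqrt (1 - (y / M) ^ 2) = Real.sqrt (M ^ 2 - y ^ 2) / M := by
        rw [show 1 - (y / M) ^ 2 = (M ^ 2 - y ^ 2) / M ^ 2 by field_simp,
          Real.sqrt_div' _ (by positivity), Real.sqrt_sq hM.le]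
      have hd := (Real.hasDerivAt_arcsin (x := y / M) (by linarith) hy1.ne).comp y
        ((hasDerivAt_id y).div_const M)
      rw [e2] at hd
      refine hd.congr_deriv ?_
      field_simp)
  refine ⟨ξ, hξ.1, hξ.2, ?_⟩
  have : b - a ≠ 0 := by linarith
  rw [eq_div_iff this] at h
  rw [← h]; ring

/-- Purely algebraic step. -/
lemma pek_alg (e₁ e₂ s₁ s₂ T K : ℝ) (hT : 0 < T) (h1 : T ≤ s₁) (h2 : T ≤ s₂)
    (he1 : 0 < e₁) (hs : s₂ ≤ s₁)
    (E1 : e₁ + e₁ / s₁ = π) (E2 : e₂ + e₂ / s₂ = π) (hK : s₁ ^ 2 - s₂ ^ 2 ≤ K) :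
    |e₂ - e₁| ≤ π * (K / (2 * T ^ 3)) := by
  have p1 : 0 < s₁ := by linarith
  have p2 : 0 < s₂ := by linarith
  have hpi := Real.pi_pos
  have hu : e₁ ≤ π := by have := div_pos he1 p1; linarith
  set u := (s₁ ^ 2 - s₂ ^ 2) / (s₁ * s₂ * (s₁ + s₂)) with hudef
  have hu0 : 0 ≤ u := by
    apply div_nonneg
    · nlinarith
    · positivity
  have hK0 : 0 ≤ K := by nlinarith
  have huK : u ≤ K / (2 * T ^ 3) := by
    apply div_le_div₀ hK0 hK (by positivity)
    have : T * T * (T + T) ≤ s₁ * s₂ * (s₁ + s₂) := by gcongr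
    nlinarith
  have key : (e₁ - e₂) * (1 + 1 / s₂) = e₁ * u := by
    have a1 : 1 / s₂ - 1 / s₁ = u := by
      rw [hudef]; field_simp; ring
    have b1 : e₁ + e₁ * (1 / s₁) = π := by rw [← E1]; ring
    have b2 : e₂ + e₂ * (1 / s₂) = π := by rw [← E2]; ring
    rw [← a1]; linear_combination b1 - b2
  have hi : 0 < 1 / s₂ := by positivity
  have h0 : 0 ≤ e₁ - e₂ := by
    by_contra hc
    push Not at hc
    have : 0 ≤ e₁ * u := by positivity
    nlinarith
  have : e₁ - e₂ ≤ e₁ * u := by nlinarith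
  rw [abs_sub_comm, abs_of_nonneg h0]
  calc e₁ - e₂ ≤ e₁ * u := this
    _ ≤ π * (K / (2 * T ^ 3)) := by gcongr

/-- For every `α ∈ (1/3, 1)` and all `n₁ > 1`, `d > 0`, there are `C > 0`, `k₀ > 0` such that
for every `k ≥ k₀` and every `j ∈ {1,…,N − ⌊N^α⌋ − 2}`:
`|σ_{j+2} − 2σ_{j+1} + σ_j| ≤ C·N^{1−3α}`. -/
theorem mode_second_difference_estimate (α n₁ d : ℝ)
    (hα : α ∈ Set.Ioo (1 / 3 : ℝ) 1) (hn : 1 < n₁) (hd : 0 < d) :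
    ∃ C > (0 : ℝ), ∃ k₀ > (0 : ℝ), ∀ k ≥ k₀, ∀ σ : ℕ → ℝ, IsModeFamily n₁ d k σ →
      ∀ j : ℕ, 1 ≤ j → j ≤ pekN n₁ d k - Nat.floor ((pekN n₁ d k : ℝ) ^ α) - 2 →
        |σ (j + 2) - 2 * σ (j + 1) + σ j| ≤ C * (pekN n₁ d k : ℝ) ^ (1 - 3 * α) := by
  obtain ⟨hα1, hα2⟩ := hα
  have hpi := Real.pi_pos
  have hpi3 := Real.pi_gt_three
  refine ⟨6 * π ^ 3, by positivity, 1, one_pos, ?_⟩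
  intro k hk σ hσ j hj hjN
  unfold IsModeFamily at hσ
  set N := pekN n₁ d k with hN
  set M := pekM n₁ d k with hM
  set f := Nat.floor ((N : ℝ) ^ α) with hf
  have hle : j + 2 + f ≤ N := by omega
  have hN1 : (1 : ℝ) ≤ N := by exact_mod_cast (by omega : 1 ≤ N)
  have hN0 : (0 : ℝ) < N := by linarith
  obtain ⟨a1, a2, a3⟩ := hσ j hj (by omega)
  obtain ⟨b1, b2, b3⟩ := hσ (j + 1) (by omega) (by omega)
  obtain ⟨c1, c2, c3⟩ := hσ (j + 2) (by omega) (by omega)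
  have A := pek_phase M _ j a2.1 a2.2 a1.1 a1.2 a3
  have B := pek_phase M _ (j + 1) b2.1 b2.2 b1.1 b1.2 b3
  have Cc := pek_phase M _ (j + 2) c2.1 c2.2 c1.1 c1.2 c3
  set a := σ j
  set b := σ (j + 1)
  set c := σ (j + 2)
  have hMpos : 0 < M := a2.1.trans a2.2
  have hNM : (N : ℝ) * π ≤ M := by
    have := Nat.floor_le (a := M / π) (by positivity)
    rwa [le_div_iff₀ hpi] at this
  have hMN : M ≤ 2 * π * N := by
    have := Nat.lt_floor_add_one (M / π)
    rw [div_lt_iff₀ hpi] at this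
    have h' : M < ((N : ℝ) + 1) * π := this
    nlinarith
  push_cast at a1 b1 c1 B Cc
  have hab : a < b := by linarith [a1.2, b1.1]
  have hbc : b < c := by linarith [b1.2, c1.1]
  have hca : c - a < 3 * π := by linarith [c1.2, a1.1]
  obtain ⟨x, hx1, hx2, hx⟩ := pek_mvt M a b a2.1 hab b2.2
  obtain ⟨y, hy1, hy2, hy⟩ := pek_mvt M b c b2.1 hbc c2.2
  have ha0 : 0 < a := a2.1
  have hcM : c < M := c2.2
  have hNα : (1 : ℝ) ≤ (N : ℝ) ^ α := Real.one_le_rpow hN1 (by linarith)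
  have hcc : c ≤ (j + 2) * π := by
    have : 0 ≤ Real.arcsin (c / M) := Real.arcsin_nonneg.2 (div_nonneg c2.1.le hMpos.le)
    linarith
  have hfr : (N : ℝ) ^ α ≤ 2 * f := by
    have h1 := Nat.lt_floor_add_one ((N : ℝ) ^ α)
    have h2 : (1 : ℝ) ≤ f := by
      exact_mod_cast Nat.le_floor (by simpa using hNα)
    rw [← hf] at h1
    linarith
  have hleR : (j : ℝ) + 2 + f ≤ N := by exact_mod_cast hle
  set T := (N : ℝ) ^ α with hT
  have hTN : T ≤ N := by
    calc T ≤ (N : ℝ) ^ (1 : ℝ) := Real.rpow_le_rpow_of_exponent_le hN1 hα2.le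
      _ = N := Real.rpow_one _
  have hMc : T ≤ M - c := by
    have h1 : ((j : ℝ) + 2 + f) * π ≤ N * π := by gcongr
    have h2 : (f : ℝ) * 2 ≤ f * π := by gcongr; linarith
    linarith
  have hT0 : 0 < T := by linarith
  have hTM : T ≤ M := by linarith [c2.1]
  have hTy : T ^ 2 ≤ M ^ 2 - y ^ 2 := by
    have h1 : T ≤ M - y := by linarith
    have h2 : T ≤ M + y := by linarith
    have h3 : T * T ≤ (M - y) * (M + y) := mul_le_mul h1 h2 hT0.le (by linarith)
    linarith only [h3, (by ring : T ^ 2 = T * T), (by ring : M ^ 2 - y ^ 2 = (M - y) * (M + y))]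
  have hxy : x ^ 2 ≤ y ^ 2 := pow_le_pow_left₀ (by linarith) (by linarith) 2
  have hs1 : T ≤ Real.sqrt (M ^ 2 - x ^ 2) := Real.le_sqrt_of_sq_le (by linarith)
  have hs2 : T ≤ Real.sqrt (M ^ 2 - y ^ 2) := Real.le_sqrt_of_sq_le hTy
  have hK : Real.sqrt (M ^ 2 - x ^ 2) ^ 2 - Real.sqrt (M ^ 2 - y ^ 2) ^ 2 ≤ 12 * π ^ 2 * N := by
    rw [Real.sq_sqrt (by linarith [sq_nonneg T]), Real.sq_sqrt (by linarith [sq_nonneg T])]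
    have h1 : y - x ≤ 3 * π := by linarith
    have h2 : y + x ≤ 4 * π * N := by linarith
    have h3 : (y - x) * (y + x) ≤ 3 * π * (4 * π * N) :=
      mul_le_mul h1 h2 (by linarith) (by positivity)
    linarith only [h3, (by ring : M ^ 2 - x ^ 2 - (M ^ 2 - y ^ 2) = (y - x) * (y + x)),
      (by ring : 3 * π * (4 * π * (N : ℝ)) = 12 * π ^ 2 * N)]
  have main := pek_alg (b - a) (c - b) _ _ T _ hT0 hs1 hs2 (by linarith)
    (Real.sqrt_le_sqrt (by linarith)) (by rw [← hx]; linarith) (by rw [← hy]; linarith) hK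
  have hpow : (N : ℝ) ^ (1 - 3 * α) = N / T ^ 3 := by
    rw [Real.rpow_sub hN0, Real.rpow_one, hT, mul_comm 3 α, Real.rpow_mul hN0.le]
    norm_num
  rw [hpow, show c - 2 * b + a = (c - b) - (b - a) by ring]
  refine main.trans (le_of_eq ?_)
  field_simp
  ring
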